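/- arXiv:1805.02163 — 2 statements merged into one kernel-verified Lean document; each statement's English description precedes it below -/
import Mathlib

section
/- Let N ≥ 1 be an integer and let s be a real number with 2N+1 < s < 2N+2. Then Σ_{j=0}^{2N} C(s,j)·(−1/2)^j ≥ 4^{−N}. -/
/-- The generalized binomial coefficient `C(s, j) = s(s-1)⋯(s-j+1)/j!`. -/
noncomputable def genBinom (s : ℝ) (j : ℕ) : ℝ :=
  (descPochhammer ℝ j).eval s / (Nat.factorial j)

/-- Pascal's rule for generalized binomial coefficients. -/
theorem genBinom_add_one_succ (s : ℝ) (k : ℕ) :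
    genBinom (s + 1) (k + 1) = genBinom s (k + 1) + genBinom s k := by
  have h : (descPochhammer ℝ (k + 1)).eval (s + 1) = (s + 1) * (descPochhammer ℝ k).eval s := by
    simp [descPochhammer_succ_left]
  unfold genBinom
  rw [h, descPochhammer_succ_eval, Nat.factorial_succ]
  push_cast
  field_simp
  ring

theorem genBinom_nonneg {s : ℝ} {k : ℕ} (h : (k : ℝ) - 1 ≤ s) : 0 ≤ genBinom s k :=
  div_nonneg (descPochhammer_nonneg h) (Nat.cast_nonneg _)

theorem sum_range_genBinom_add_one (s x : ℝ) (m : ℕ) :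
    ∑ j ∈ Finset.range (m + 1), genBinom (s + 1) j * x ^ j =
      (1 + x) * ∑ j ∈ Finset.range m, genBinom s j * x ^ j + genBinom s m * x ^ m := by
  induction m with
  | zero => simp [genBinom]
  | succ m ih =>
    rw [Finset.sum_range_succ, ih, Finset.sum_range_succ _ m, genBinom_add_one_succ]
    ring

/-- For `N ≥ 1` and `2N+1 < s < 2N+2`, one has
`∑_{j=0}^{2N} C(s,j) (−1/2)^j ≥ 4^{−N}`. -/
theorem genBinom_alternating_sum_lower_bound (N : ℕ) (hN : 1 ≤ N) (s : ℝ)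
    (h1 : 2 * (N : ℝ) + 1 < s) (h2 : s < 2 * (N : ℝ) + 2) :
    ((4 : ℝ) ^ N)⁻¹ ≤ ∑ j ∈ Finset.range (2 * N + 1), genBinom s j * (-(1 / 2) : ℝ) ^ j := by
  clear hN h2
  obtain ⟨r, rfl⟩ : ∃ r, s = 2 * (N : ℝ) + r := ⟨s - 2 * N, by ring⟩
  have hr : 1 ≤ r := by linarith
  clear h1
  induction N with
  | zero => simp [genBinom]
  | succ N ih =>
    have hcast : 2 * ((N + 1 : ℕ) : ℝ) + r = 2 * (N : ℝ) + r + 1 + 1 := by push_cast; ring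
    have hpow : (-(1 / 2) : ℝ) ^ (2 * N) = ((4 : ℝ) ^ N)⁻¹ := by
      rw [pow_mul, ← inv_pow]; norm_num
    have hnonneg : 0 ≤ genBinom (2 * (N : ℝ) + r) (2 * N + 1 + 1) :=
      genBinom_nonneg (by push_cast; linarith)
    rw [hcast, show 2 * (N + 1) + 1 = 2 * N + 1 + 1 + 1 by ring,
      sum_range_genBinom_add_one, sum_range_genBinom_add_one, genBinom_add_one_succ,
      pow_succ _ (2 * N + 1), pow_succ _ (2 * N), hpow, pow_succ, mul_inv]
    have := mul_nonneg hnonneg (show 0 ≤ ((4 : ℝ) ^ N)⁻¹ by positivity)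
    linarith
end

section
/- Let s be a real number with −1 < s < 0 and define f_s(t) = ((1+t)^s − (1−t)^s)/t for t ∈ (0,1). Then: (a) f_s(t) < 0 for all t ∈ (0,1); (b) f_s is strictly decreasing on (0,1); (c) f_s(t) < 2s for all t ∈ (0,1), and f_s(t) tends to 2s as t → 0⁺ (limit along the filter 𝓝[>] 0); (d) f_s(t) tends to −∞ as t → 1⁻ (limit along 𝓝[<] 1 is atBot). -/
open Filter Set

lemma hasDerivAt_one_add_rpow (p : ℝ) {t : ℝ} (ht : -1 < t) :
    HasDerivAt (fun t : ℝ => (1 + t) ^ p) (p * (1 + t) ^ (p - 1)) t := by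
  simpa using ((hasDerivAt_id t).const_add 1).rpow_const (p := p)
    (Or.inl (by simpa using (by linarith : 1 + t ≠ 0)))

lemma hasDerivAt_one_sub_rpow (p : ℝ) {t : ℝ} (ht : t < 1) :
    HasDerivAt (fun t : ℝ => (1 - t) ^ p) (-(p * (1 - t) ^ (p - 1))) t := by
  simpa using ((hasDerivAt_id t).const_sub 1).rpow_const (p := p)
    (Or.inl (by simpa using (by linarith : 1 - t ≠ 0)))

lemma hasDerivAt_one_add_rpow_sub_one_sub_rpow (p : ℝ) {t : ℝ} (ht : -1 < t) (ht' : t < 1) :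
    HasDerivAt (fun t : ℝ => (1 + t) ^ p - (1 - t) ^ p)
      (p * ((1 + t) ^ (p - 1) + (1 - t) ^ (p - 1))) t :=
  ((hasDerivAt_one_add_rpow p ht).sub (hasDerivAt_one_sub_rpow p ht')).congr_deriv (by ring)

lemma hasDerivAt_one_add_rpow_add_one_sub_rpow (p : ℝ) {t : ℝ} (ht : -1 < t) (ht' : t < 1) :
    HasDerivAt (fun t : ℝ => (1 + t) ^ p + (1 - t) ^ p)
      (p * ((1 + t) ^ (p - 1) - (1 - t) ^ (p - 1))) t :=
  ((hasDerivAt_one_add_rpow p ht).add (hasDerivAt_one_sub_rpow p ht')).congr_deriv (by ring)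

lemma strictMonoOn_one_add_rpow_add_one_sub_rpow {p : ℝ} (hp : p < 0) :
    StrictMonoOn (fun t : ℝ => (1 + t) ^ p + (1 - t) ^ p) (Ico 0 1) := by
  refine strictMonoOn_of_deriv_pos (convex_Ico 0 1) (fun t ht =>
    (hasDerivAt_one_add_rpow_add_one_sub_rpow p (by linarith [ht.1])
      ht.2).continuousAt.continuousWithinAt) fun t ht => ?_
  rw [interior_Ico] at ht
  rw [(hasDerivAt_one_add_rpow_add_one_sub_rpow p (by linarith [ht.1]) ht.2).deriv]
  refine mul_pos_of_neg_of_neg hp (sub_neg.2 ?_)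
  exact Real.rpow_lt_rpow_of_neg (by linarith [ht.2]) (by linarith [ht.1]) (by linarith)

lemma strictConcaveOn_one_add_rpow_sub_one_sub_rpow {p : ℝ} (hp : p < 0) :
    StrictConcaveOn ℝ (Ico 0 1) (fun t : ℝ => (1 + t) ^ p - (1 - t) ^ p) := by
  refine StrictAntiOn.strictConcaveOn_of_deriv (convex_Ico 0 1) (fun t ht =>
    (hasDerivAt_one_add_rpow_sub_one_sub_rpow p (by linarith [ht.1])
      ht.2).continuousAt.continuousWithinAt) ?_
  rw [interior_Ico]
  intro x hx y hy hxy
  rw [(hasDerivAt_one_add_rpow_sub_one_sub_rpow p (by linarith [hx.1]) hx.2).deriv,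
    (hasDerivAt_one_add_rpow_sub_one_sub_rpow p (by linarith [hy.1]) hy.2).deriv]
  exact mul_lt_mul_of_neg_left (strictMonoOn_one_add_rpow_add_one_sub_rpow (by linarith)
    (Ioo_subset_Ico_self hx) (Ioo_subset_Ico_self hy) hxy) hp

/-- Properties of `f_s(t) = ((1+t)^s − (1−t)^s)/t` for `−1 < s < 0` on `(0,1)`:
(a) `f_s < 0`; (b) `f_s` is strictly decreasing; (c) `f_s < 2s` and
`f_s(t) → 2s` as `t → 0⁺`; (d) `f_s(t) → −∞` as `t → 1⁻`. -/
theorem fs_neg_exponent_properties (s : ℝ) (hs1 : -1 < s) (hs0 : s < 0) :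
    (∀ t ∈ Set.Ioo (0 : ℝ) 1, ((1 + t) ^ s - (1 - t) ^ s) / t < 0) ∧
    StrictAntiOn (fun t : ℝ => ((1 + t) ^ s - (1 - t) ^ s) / t) (Set.Ioo 0 1) ∧
    (∀ t ∈ Set.Ioo (0 : ℝ) 1, ((1 + t) ^ s - (1 - t) ^ s) / t < 2 * s) ∧
    Tendsto (fun t : ℝ => ((1 + t) ^ s - (1 - t) ^ s) / t)
      (nhdsWithin 0 (Set.Ioi 0)) (nhds (2 * s)) ∧
    Tendsto (fun t : ℝ => ((1 + t) ^ s - (1 - t) ^ s) / t)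
      (nhdsWithin 1 (Set.Iio 1)) atBot := by
  have anti : StrictAntiOn (fun t : ℝ => ((1 + t) ^ s - (1 - t) ^ s) / t) (Set.Ioo 0 1) := by
    intro x hx y hy hxy
    simpa using (strictConcaveOn_one_add_rpow_sub_one_sub_rpow hs0).secant_strict_mono
      (left_mem_Ico.2 one_pos) (Ioo_subset_Ico_self hx) (Ioo_subset_Ico_self hy)
      hx.1.ne' hy.1.ne' hxy
  have lim : Tendsto (fun t : ℝ => ((1 + t) ^ s - (1 - t) ^ s) / t)
      (nhdsWithin 0 (Set.Ioi 0)) (nhds (2 * s)) := by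
    have h := (hasDerivAt_one_add_rpow_sub_one_sub_rpow s (t := 0)
      (by norm_num) one_pos).tendsto_slope_zero_right
    convert h using 2
    · simp [div_eq_inv_mul]
    · norm_num [mul_comm]
  have lt_limit : ∀ t ∈ Set.Ioo (0 : ℝ) 1, ((1 + t) ^ s - (1 - t) ^ s) / t < 2 * s := by
    intro t ht
    have ht2 : t / 2 ∈ Set.Ioo (0 : ℝ) 1 := ⟨by linarith [ht.1], by linarith [ht.1, ht.2]⟩
    refine (anti ht2 ht (by linarith [ht.1])).trans_le (ge_of_tendsto lim ?_)
    filter_upwards [Ioo_mem_nhdsGT ht2.1] with u hu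
    exact (anti ⟨hu.1, hu.2.trans ht2.2⟩ ht2 hu.2).le
  refine ⟨fun t ht => (lt_limit t ht).trans (by linarith), anti, lt_limit, lim, ?_⟩
  have hsub : Tendsto (fun t : ℝ => 1 - t) (nhdsWithin 1 (Set.Iio 1))
      (nhdsWithin 0 (Set.Ioi 0)) := by
    refine tendsto_nhdsWithin_iff.2 ⟨?_, ?_⟩
    · exact ((continuous_const.sub continuous_id).tendsto' 1 0 (sub_self 1)).mono_left
        nhdsWithin_le_nhds
    · filter_upwards [self_mem_nhdsWithin] with t ht using sub_pos.2 (mem_Iio.1 ht)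
  have hadd : Tendsto (fun t : ℝ => (1 + t) ^ s) (nhdsWithin 1 (Set.Iio 1))
      (nhds ((1 + 1) ^ s)) :=
    (hasDerivAt_one_add_rpow s (by norm_num)).continuousAt.tendsto.mono_left nhdsWithin_le_nhds
  have hnum := hadd.add_atBot
    (tendsto_neg_atTop_atBot.comp ((tendsto_rpow_neg_nhdsGT_zero hs0).comp hsub))
  have hinv : Tendsto (fun t : ℝ => t⁻¹) (nhdsWithin 1 (Set.Iio 1)) (nhds 1⁻¹) :=
    (tendsto_inv₀ one_ne_zero).mono_left nhdsWithin_le_nhds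
  refine (hnum.atBot_mul_pos (by norm_num) hinv).congr fun t => ?_
  simp [div_eq_mul_inv, sub_eq_add_neg]
end
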